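/- arXiv:2605.27614 — 3 statements merged into one kernel-verified Lean document; each statement's English description precedes it below -/
import Mathlib

section
/- Let D : ℂ[x] → ℂ[x] be the unique ℂ-linear map with D(xⁿ) = (1 − (−1)ⁿ)·xⁿ⁺¹ for all n ≥ 0. Then the range of D is contained in the kernel of D, the kernel of D is the (internal direct) sum of the range of D and the one-dimensional subspace ℂ·1, and ℂ·1 intersects the range of D trivially; hence ker D / range D is one-dimensional over ℂ. -/
open Polynomial

section OddEndoComplex

variable {D : Polynomial ℂ →ₗ[ℂ] Polynomial ℂ}

theorem odd_endo_apply_eq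
    (hD : ∀ n : ℕ, D (X ^ n) = ((1 : ℂ) - (-1) ^ n) • X ^ (n + 1)) (p : Polynomial ℂ) :
    D p = X * (p - p.comp (-X)) := by
  induction p using Polynomial.induction_on' with
  | add p q hp hq => rw [map_add, hp, hq, add_comp]; ring
  | monomial n a =>
    rw [← C_mul_X_pow_eq_monomial, ← smul_eq_C_mul, map_smul, hD]
    simp only [smul_eq_C_mul, map_sub, map_pow, map_neg, map_one, mul_comp, C_comp, X_pow_comp,
      neg_pow (X : Polynomial ℂ) n]
    ring

theorem odd_endo_coeff_zero
    (hD : ∀ n : ℕ, D (X ^ n) = ((1 : ℂ) - (-1) ^ n) • X ^ (n + 1)) (p : Polynomial ℂ) :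
    (D p).coeff 0 = 0 := by
  simp [odd_endo_apply_eq hD]

theorem odd_endo_coeff_succ
    (hD : ∀ n : ℕ, D (X ^ n) = ((1 : ℂ) - (-1) ^ n) • X ^ (n + 1)) (p : Polynomial ℂ) (n : ℕ) :
    (D p).coeff (n + 1) = (1 - (-1) ^ n) * p.coeff n := by
  rw [odd_endo_apply_eq hD, coeff_X_mul, coeff_sub,
    show (-X : Polynomial ℂ) = C (-1) * X by simp, comp_C_mul_X_coeff]
  ring

theorem odd_endo_apply_apply
    (hD : ∀ n : ℕ, D (X ^ n) = ((1 : ℂ) - (-1) ^ n) • X ^ (n + 1)) (p : Polynomial ℂ) :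
    D (D p) = 0 := by
  ext n
  rcases n with _ | _ | n
  · simp [odd_endo_coeff_zero hD]
  · simp [odd_endo_coeff_succ hD]
  · rcases Nat.even_or_odd n with h | h <;>
      simp [odd_endo_coeff_succ hD, pow_succ, h.neg_one_pow]

/-- A cocycle differs from its constant term by a coboundary. -/
theorem odd_endo_eq_add_C_of_apply_eq_zero
    (hD : ∀ n : ℕ, D (X ^ n) = ((1 : ℂ) - (-1) ^ n) • X ^ (n + 1)) {p : Polynomial ℂ}
    (hp : D p = 0) : D ((2⁻¹ : ℂ) • p.divX) + C (p.coeff 0) = p := by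
  ext n
  rcases n with _ | n
  · simp [odd_endo_coeff_zero hD]
  · have h : (1 - (-1) ^ (n + 1)) * p.coeff (n + 1) = 0 := by
      rw [← odd_endo_coeff_succ hD, hp, coeff_zero]
    rw [coeff_add, odd_endo_coeff_succ hD, coeff_C_succ, coeff_smul, coeff_divX, smul_eq_mul]
    linear_combination (-2⁻¹ : ℂ) * h

theorem odd_endo_mem_range_iff
    (hD : ∀ n : ℕ, D (X ^ n) = ((1 : ℂ) - (-1) ^ n) • X ^ (n + 1)) {p : Polynomial ℂ}
    (hp : D p = 0) : p ∈ LinearMap.range D ↔ p.coeff 0 = 0 := by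
  constructor
  · rintro ⟨q, rfl⟩
    exact odd_endo_coeff_zero hD q
  · intro h
    have := odd_endo_eq_add_C_of_apply_eq_zero hD hp
    rw [h, C_0, add_zero] at this
    exact ⟨_, this⟩

theorem odd_endo_apply_C
    (hD : ∀ n : ℕ, D (X ^ n) = ((1 : ℂ) - (-1) ^ n) • X ^ (n + 1)) (c : ℂ) : D (C c) = 0 := by
  simp [odd_endo_apply_eq hD]

end OddEndoComplex

/-- Let `D : ℂ[x] → ℂ[x]` be the ℂ-linear map with `D(xⁿ) = (1 − (−1)ⁿ)·xⁿ⁺¹`.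
Then `range D ⊆ ker D`, the kernel of `D` is the internal direct sum of `range D` and
the line `ℂ·1`, these two intersect trivially, and `ker D / range D` is one-dimensional. -/
theorem odd_endo_complex_cohomology
    (D : Polynomial ℂ →ₗ[ℂ] Polynomial ℂ)
    (hD : ∀ n : ℕ, D (X ^ n) = ((1 : ℂ) - (-1) ^ n) • X ^ (n + 1)) :
    LinearMap.range D ≤ LinearMap.ker D ∧
      LinearMap.ker D = LinearMap.range D ⊔ (ℂ ∙ (1 : Polynomial ℂ)) ∧
      (ℂ ∙ (1 : Polynomial ℂ)) ⊓ LinearMap.range D = ⊥ ∧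
      Module.finrank ℂ
        (↥(LinearMap.ker D) ⧸
          (LinearMap.range D).comap (LinearMap.ker D).subtype) = 1 := by
  have hle : LinearMap.range D ≤ LinearMap.ker D := by
    rintro _ ⟨p, rfl⟩
    exact odd_endo_apply_apply hD p
  refine ⟨hle, le_antisymm ?_ (sup_le hle ?_), ?_, ?_⟩
  · intro p hp
    rw [← odd_endo_eq_add_C_of_apply_eq_zero hD hp]
    refine Submodule.add_mem_sup ⟨_, rfl⟩ (Submodule.mem_span_singleton.2 ⟨p.coeff 0, ?_⟩)
    rw [smul_eq_C_mul, mul_one]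
  · rw [Submodule.span_singleton_le_iff_mem, LinearMap.mem_ker, ← C_1]
    exact odd_endo_apply_C hD 1
  · rw [eq_bot_iff]
    rintro p ⟨hp, q, rfl⟩
    obtain ⟨c, hc⟩ := Submodule.mem_span_singleton.1 hp
    have h := odd_endo_coeff_zero hD q
    rw [← hc, coeff_smul, coeff_one_zero, smul_eq_mul, mul_one] at h
    rw [Submodule.mem_bot, ← hc, h, zero_smul]
  · let f : LinearMap.ker D →ₗ[ℂ] ℂ := (lcoeff ℂ 0).comp (LinearMap.ker D).subtype
    have hf : Function.Surjective f := fun c => ⟨⟨C c, odd_endo_apply_C hD c⟩, coeff_C_zero⟩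
    have hker : (LinearMap.range D).comap (LinearMap.ker D).subtype = LinearMap.ker f := by
      ext p
      exact odd_endo_mem_range_iff hD p.2
    rw [hker, (f.quotKerEquivOfSurjective hf).finrank_eq, Module.finrank_self]
end

section
/- Let P = ℂ[x,y]. Let E₀, E₁ : P → P be the unique ℂ-linear maps with E₀(xⁿyᵐ) = (1 + (−1)ⁿ)·xⁿ⁺¹yᵐ and E₁(xⁿyᵐ) = (1 + (−1)ⁿ⁺ᵐ)·xⁿ⁺¹yᵐ for all n, m ≥ 0. Then ker E₀ = range E₀, but ker E₁ ≠ range E₁: the element y lies in ker E₁ but not in range E₁. -/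
open MvPolynomial

theorem monomial_one_eq_X_pow_mul_X_pow {R : Type*} [CommSemiring R] (s : Fin 2 →₀ ℕ) :
    monomial s (1 : R) = X 0 ^ s 0 * X 1 ^ s 1 := by
  rw [monomial_eq, Finsupp.prod_fintype _ _ (fun i => pow_zero _)]
  simp [Fin.prod_univ_two]

theorem linearMap_ext_X_pow_mul_X_pow {R M : Type*} [CommSemiring R] [AddCommMonoid M]
    [Module R M] {f g : MvPolynomial (Fin 2) R →ₗ[R] M}
    (h : ∀ n m : ℕ, f (X 0 ^ n * X 1 ^ m) = g (X 0 ^ n * X 1 ^ m)) : f = g := by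
  refine (basisMonomials (Fin 2) R).ext fun s => ?_
  simp only [coe_basisMonomials, monomial_one_eq_X_pow_mul_X_pow]
  exact h _ _

theorem exists_linearMap_X_pow_mul_X_pow {R M : Type*} [CommSemiring R] [AddCommMonoid M]
    [Module R M] (v : ℕ → ℕ → M) :
    ∃ f : MvPolynomial (Fin 2) R →ₗ[R] M, ∀ n m : ℕ, f (X 0 ^ n * X 1 ^ m) = v n m := by
  refine ⟨(basisMonomials (Fin 2) R).constr ℕ fun s => v (s 0) (s 1), fun n m => ?_⟩
  have h := (basisMonomials (Fin 2) R).constr_basis ℕ (fun s => v (s 0) (s 1))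
    (Finsupp.single 0 n + Finsupp.single 1 m)
  simp only [coe_basisMonomials, monomial_one_eq_X_pow_mul_X_pow] at h
  simpa using h

/-- A contracting homotopy gives exactness. -/
theorem ker_eq_range_of_homotopy {R M : Type*} [CommSemiring R] [AddCommMonoid M] [Module R M]
    {E H : M →ₗ[R] M} (hE : E ∘ₗ E = 0) (hH : E ∘ₗ H + H ∘ₗ E = LinearMap.id) :
    LinearMap.ker E = LinearMap.range E := by
  refine le_antisymm (fun p hp => ⟨H p, ?_⟩) (LinearMap.range_le_ker_iff.2 hE)
  have h := LinearMap.congr_fun hH p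
  simpa [LinearMap.mem_ker.1 hp] using h

/-- Let `P = ℂ[x,y]` and let `E₀, E₁ : P → P` be the ℂ-linear maps with
`E₀(xⁿyᵐ) = (1 + (−1)ⁿ)·xⁿ⁺¹yᵐ` and `E₁(xⁿyᵐ) = (1 + (−1)ⁿ⁺ᵐ)·xⁿ⁺¹yᵐ`.
Then `ker E₀ = range E₀`, but `ker E₁ ≠ range E₁`: `y ∈ ker E₁` while `y ∉ range E₁`. -/
theorem even_vs_odd_second_variable
    (E₀ E₁ : MvPolynomial (Fin 2) ℂ →ₗ[ℂ] MvPolynomial (Fin 2) ℂ)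
    (hE₀ : ∀ n m : ℕ,
      E₀ (X 0 ^ n * X 1 ^ m) = ((1 : ℂ) + (-1) ^ n) • (X 0 ^ (n + 1) * X 1 ^ m))
    (hE₁ : ∀ n m : ℕ,
      E₁ (X 0 ^ n * X 1 ^ m) = ((1 : ℂ) + (-1) ^ (n + m)) • (X 0 ^ (n + 1) * X 1 ^ m)) :
    LinearMap.ker E₀ = LinearMap.range E₀ ∧
      LinearMap.ker E₁ ≠ LinearMap.range E₁ ∧
      (X 1 : MvPolynomial (Fin 2) ℂ) ∈ LinearMap.ker E₁ ∧
      (X 1 : MvPolynomial (Fin 2) ℂ) ∉ LinearMap.range E₁ := by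
  have hker : (X 1 : MvPolynomial (Fin 2) ℂ) ∈ LinearMap.ker E₁ := by
    simpa using hE₁ 0 1
  have hrange : (X 1 : MvPolynomial (Fin 2) ℂ) ∉ LinearMap.range E₁ := by
    rintro ⟨p, hp⟩
    have h : (aeval (![0, 1] : Fin 2 → ℂ)).toLinearMap ∘ₗ E₁ = 0 :=
      linearMap_ext_X_pow_mul_X_pow fun n m => by simp [hE₁]
    simpa [hp] using LinearMap.congr_fun h p
  refine ⟨?_, fun h => hrange (h ▸ hker), hker, hrange⟩
  obtain ⟨H, hH⟩ := exists_linearMap_X_pow_mul_X_pow (R := ℂ) fun n m =>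
    if Even n then (0 : MvPolynomial (Fin 2) ℂ) else (2⁻¹ : ℂ) • (X 0 ^ (n - 1) * X 1 ^ m)
  refine ker_eq_range_of_homotopy (H := H) ?_ ?_
  · refine linearMap_ext_X_pow_mul_X_pow fun n m => ?_
    rcases Nat.even_or_odd n with hn | hn <;> simp [hE₀, pow_succ (-1 : ℂ), hn.neg_one_pow]
  · refine linearMap_ext_X_pow_mul_X_pow fun n m => ?_
    rcases Nat.even_or_odd n with hn | ⟨k, rfl⟩
    · simp only [LinearMap.add_apply, LinearMap.comp_apply, LinearMap.id_apply, hH, hE₀, map_smul,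
        hn, hn.neg_one_pow, Nat.even_add_one, not_true_eq_false, if_true, if_false, map_zero,
        zero_add, Nat.add_sub_cancel, smul_smul]
      norm_num
    · have hk : ¬ Even (2 * k + 1) := by simp
      simp only [LinearMap.add_apply, LinearMap.comp_apply, LinearMap.id_apply, hH, hE₀, map_smul,
        hk, if_false, Nat.add_sub_cancel, smul_smul, (even_two_mul k).neg_one_pow,
        (odd_two_mul_add_one k).neg_one_pow]
      norm_num
end

section
/- Let R be a commutative ring, f ∈ R, and B = R[y]/(y² − f). In the commutative ring B ⊗_R B set u = y ⊗ 1 − 1 ⊗ y and v = y ⊗ 1 + 1 ⊗ y. Then u·v = 0, the kernel of multiplication by u on B ⊗_R B equals the image of multiplication by v, and the kernel of multiplication by v equals the image of multiplication by u. In other words, the two-periodic complex ⋯ →(·v) B ⊗_R B →(·u) B ⊗_R B →(·v) ⋯ is exact. -/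
open Polynomial TensorProduct

section

variable {R B : Type*} [CommRing R] [CommRing B] [Algebra R B] {y : B}

/-- If `B` is spanned over `R` by `1` and `y`, then every element of `A ⊗[R] B` has the form
`p ⊗ 1 + q ⊗ y`. -/
theorem TensorProduct.exists_eq_tmul_one_add_tmul {A : Type*} [CommRing A] [Algebra R A]
    (hspan : ∀ b : B, ∃ r s : R, b = r • 1 + s • y) (t : A ⊗[R] B) :
    ∃ p q : A, t = p ⊗ₜ[R] 1 + q ⊗ₜ[R] y := by
  induction t with
  | zero => exact ⟨0, 0, by simp⟩
  | tmul a b =>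
    obtain ⟨r, s, rfl⟩ := hspan b
    exact ⟨r • a, s • a, by simp [tmul_add, smul_tmul]⟩
  | add t₁ t₂ h₁ h₂ =>
    obtain ⟨p₁, q₁, rfl⟩ := h₁
    obtain ⟨p₂, q₂, rfl⟩ := h₂
    exact ⟨p₁ + p₂, q₁ + q₂, by simp only [add_tmul]; abel⟩

/-- A linear functional with `1 ↦ 0` and `y ↦ 1` extracts the coefficient of `y`. -/
theorem TensorProduct.eq_zero_of_tmul_one_add_tmul_eq_zero {A : Type*} [CommRing A] [Algebra R A]
    (φ : B →ₗ[R] R) (h1 : φ 1 = 0) (hy : φ y = 1) {p q : A}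
    (h : p ⊗ₜ[R] (1 : B) + q ⊗ₜ[R] y = 0) : q = 0 := by
  simpa [h1, hy] using congrArg (TensorProduct.rid R A ∘ φ.lTensor A) h

/-- Two-periodic exactness for an algebra with `R`-basis `1, y`, where `y ^ 2 = f`. -/
theorem TensorProduct.two_periodic_exactness {f : R} (hf : y * y = algebraMap R B f)
    (hspan : ∀ b : B, ∃ r s : R, b = r • 1 + s • y)
    (φ : B →ₗ[R] R) (h1 : φ 1 = 0) (hy : φ y = 1) :
    (y ⊗ₜ[R] (1 : B) - (1 : B) ⊗ₜ[R] y) * (y ⊗ₜ[R] (1 : B) + (1 : B) ⊗ₜ[R] y) = 0 ∧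
      (∀ t : B ⊗[R] B, (y ⊗ₜ[R] (1 : B) - (1 : B) ⊗ₜ[R] y) * t = 0 ↔
        ∃ s : B ⊗[R] B, (y ⊗ₜ[R] (1 : B) + (1 : B) ⊗ₜ[R] y) * s = t) ∧
      (∀ t : B ⊗[R] B, (y ⊗ₜ[R] (1 : B) + (1 : B) ⊗ₜ[R] y) * t = 0 ↔
        ∃ s : B ⊗[R] B, (y ⊗ₜ[R] (1 : B) - (1 : B) ⊗ₜ[R] y) * s = t) := by
  have hz (q : B) : q ⊗ₜ[R] (y * y) = (q * (y * y)) ⊗ₜ[R] (1 : B) := by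
    rw [hf, Algebra.algebraMap_eq_smul_one, tmul_smul, mul_smul_comm, mul_one, smul_tmul']
  have huv : (y ⊗ₜ[R] (1 : B) - (1 : B) ⊗ₜ[R] y) *
      (y ⊗ₜ[R] (1 : B) + (1 : B) ⊗ₜ[R] y) = 0 := by
    simp only [sub_mul, mul_add, Algebra.TensorProduct.tmul_mul_tmul, mul_one, one_mul, hz]
    abel
  refine ⟨huv, fun t => ⟨fun ht => ?_, ?_⟩, fun t => ⟨fun ht => ?_, ?_⟩⟩
  · obtain ⟨p, q, rfl⟩ := exists_eq_tmul_one_add_tmul hspan t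
    have h : (y * p - q * (y * y)) ⊗ₜ[R] (1 : B) + (y * q - p) ⊗ₜ[R] y = 0 := by
      rw [← ht]
      simp only [sub_mul, mul_add, Algebra.TensorProduct.tmul_mul_tmul, mul_one, one_mul, hz,
        sub_tmul]
      abel
    have hp := sub_eq_zero.mp (eq_zero_of_tmul_one_add_tmul_eq_zero φ h1 hy h)
    exact ⟨q ⊗ₜ 1, by simp [add_mul, hp]⟩
  · rintro ⟨s, rfl⟩
    rw [← mul_assoc, huv, zero_mul]
  · obtain ⟨p, q, rfl⟩ := exists_eq_tmul_one_add_tmul hspan t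
    have h : (y * p + q * (y * y)) ⊗ₜ[R] (1 : B) + (y * q + p) ⊗ₜ[R] y = 0 := by
      rw [← ht]
      simp only [add_mul, mul_add, Algebra.TensorProduct.tmul_mul_tmul, mul_one, one_mul, hz,
        add_tmul]
      abel
    have hp := eq_neg_of_add_eq_zero_right (eq_zero_of_tmul_one_add_tmul_eq_zero φ h1 hy h)
    exact ⟨-(q ⊗ₜ 1), by simp [sub_mul, hp, neg_tmul]; abel⟩
  · rintro ⟨s, rfl⟩
    rw [← mul_assoc, mul_comm (y ⊗ₜ[R] (1 : B) + _), huv, zero_mul]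

end

/-- The quotient `R[X] ⧸ (X ^ 2 - f)` is spanned over `R` by `1` and the class of `X`. -/
theorem Polynomial.exists_eq_smul_one_add_smul_mk_X {R : Type*} [CommRing R] (f : R)
    (b : R[X] ⧸ Ideal.span {(X : R[X]) ^ 2 - C f}) :
    ∃ r s : R, b = r • 1 + s • Ideal.Quotient.mk _ (X : R[X]) := by
  obtain ⟨p, rfl⟩ := Ideal.Quotient.mk_surjective b
  have hmonic : ((X : R[X]) ^ 2 - C f).Monic := monic_X_pow_sub_C f two_ne_zero
  have hdeg : (p %ₘ (X ^ 2 - C f)).natDegree ≤ 1 := by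
    nontriviality R
    have := natDegree_modByMonic_lt p hmonic
      (fun h => by simpa using congrArg natDegree h)
    rw [natDegree_X_pow_sub_C] at this
    lia
  obtain ⟨s, r, hsr⟩ := exists_eq_X_add_C_of_natDegree_le_one hdeg
  refine ⟨r, s, ?_⟩
  change _ = Ideal.Quotient.mk _ (r • 1 + s • X)
  rw [Ideal.Quotient.mk_eq_mk_iff_sub_mem, Ideal.mem_span_singleton]
  refine ⟨p /ₘ (X ^ 2 - C f), ?_⟩
  have := modByMonic_add_div p (X ^ 2 - C f)
  rw [hsr] at this
  simp only [smul_eq_C_mul, mul_one]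
  linear_combination -this

/-- There is a functional on `R[X] ⧸ (X ^ 2 - f)` with `1 ↦ 0` and `X ↦ 1`. -/
theorem Polynomial.exists_linearMap_quotient_X_sq_sub_C {R : Type*} [CommRing R] (f : R) :
    ∃ φ : (R[X] ⧸ Ideal.span {(X : R[X]) ^ 2 - C f}) →ₗ[R] R,
      φ 1 = 0 ∧ φ (Ideal.Quotient.mk _ X) = 1 := by
  let ω : QuadraticAlgebra R f 0 := ⟨0, 1⟩
  have hω : ∀ a ∈ Ideal.span {(X : R[X]) ^ 2 - C f}, aeval ω a = 0 := by
    intro a ha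
    obtain ⟨c, rfl⟩ := Ideal.mem_span_singleton.mp ha
    have : aeval ω ((X : R[X]) ^ 2 - C f) = 0 := by
      ext <;> simp [ω, pow_two]
    rw [map_mul, this, zero_mul]
  let ψ := Ideal.Quotient.liftₐ (Ideal.span {(X : R[X]) ^ 2 - C f}) (aeval ω) hω
  let im : QuadraticAlgebra R f 0 →ₗ[R] R :=
    { toFun := QuadraticAlgebra.im, map_add' := by simp, map_smul' := by simp }
  refine ⟨im ∘ₗ ψ.toLinearMap, ?_, ?_⟩
  · change (ψ 1).im = 0
    rw [map_one, QuadraticAlgebra.im_one]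
  · change (aeval ω X).im = 1
    simp [ω]

/-- Let `R` be a commutative ring, `f ∈ R`, `B = R[y]/(y² − f)`, and in `B ⊗_R B` set
`u = y ⊗ 1 − 1 ⊗ y`, `v = y ⊗ 1 + 1 ⊗ y`. Then `u·v = 0`, the kernel of multiplication
by `u` equals the image of multiplication by `v`, and the kernel of multiplication by `v`
equals the image of multiplication by `u`: the two-periodic complex
`⋯ →(·v) B ⊗ B →(·u) B ⊗ B →(·v) ⋯` is exact. -/
theorem double_cover_two_periodic_exactness
    (R : Type*) [CommRing R] (f : R) :
    letI B := Polynomial R ⧸ Ideal.span {(X : Polynomial R) ^ 2 - C f}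
    letI y : B := Ideal.Quotient.mk _ (X : Polynomial R)
    letI u : B ⊗[R] B := y ⊗ₜ[R] (1 : B) - (1 : B) ⊗ₜ[R] y
    letI v : B ⊗[R] B := y ⊗ₜ[R] (1 : B) + (1 : B) ⊗ₜ[R] y
    u * v = 0 ∧
      (∀ t : B ⊗[R] B, u * t = 0 ↔ ∃ s : B ⊗[R] B, v * s = t) ∧
      (∀ t : B ⊗[R] B, v * t = 0 ↔ ∃ s : B ⊗[R] B, u * s = t) := by
  obtain ⟨φ, h1, hy⟩ := Polynomial.exists_linearMap_quotient_X_sq_sub_C f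
  refine TensorProduct.two_periodic_exactness (f := f) ?_
    (Polynomial.exists_eq_smul_one_add_smul_mk_X f) φ h1 hy
  change Ideal.Quotient.mk _ (X * X) = Ideal.Quotient.mk _ (C f)
  rw [Ideal.Quotient.mk_eq_mk_iff_sub_mem, ← pow_two]
  exact Ideal.mem_span_singleton_self _
end
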